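/- Let A be a Banach algebra and η an infinite cardinal. Suppose A contains bounded subsets A = {a_α : α ∈ Λ₁} and B = {b_β : β ∈ Λ₂} indexed by cofinal subsets Λ₁, Λ₂ of a common directed set (Λ,⪯) with tr|Λ₁| = tr|Λ₂| = η, and two disjoint subsets X₁, X₂ of A such that: (i) X = X₁ ∪ X₂ is an ℓ¹(η)-base in A with constant K > 0, contained in the closed ball of radius M > 0; (ii) X₁ approximates segments in the upper triangle T^u_{AB} and X₂ approximates segments in the lower triangle T^l_{AB}; (iii) either X₁ is vertically injective and X₂ is horizontally injective, or vice versa. Then there is a bounded linear surjection from A*/W(A) onto ℓ∞(η). If in addition the density character of A satisfies d(A) ≤ η, then A is extremely non-Arens regular. -/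

import Mathlib

open Filter Topology
open scoped ENNReal

noncomputable section

universe u

namespace Paper

/-- The density character of a topological space: the smallest cardinality of a dense subset. -/
def densityChar (E : Type u) [TopologicalSpace E] : Cardinal.{u} :=
  ⨅ s : {s : Set E // Dense s}, Cardinal.mk ↥(s.1)

/-- A subset of a preordered set is cofinal if every element lies below some member of it. -/
def Cofinal {Λ : Type*} [Preorder Λ] (S : Set Λ) : Prop :=
  ∀ ξ : Λ, ∃ α ∈ S, ξ ≤ α

/-- The true cardinality `tr|Λ| = min_{ξ ∈ Λ} |{α : ξ ≺ α}|` of a preordered set. -/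
def trueCard (Λ : Type u) [Preorder Λ] : Cardinal.{u} :=
  ⨅ ξ : Λ, Cardinal.mk {α : Λ // ξ < α}

variable (𝕜 : Type u) [RCLike 𝕜]

/-- An `ℓ¹(η)`-base with constant `K` in a normed space: a bounded set of cardinality `η`
such that `∑ |zₙ| ≤ K ‖∑ zₙ aₙ‖` for all scalars and all finite families of
distinct elements of the set. -/
def IsL1Base {E : Type u} [SeminormedAddCommGroup E] [NormedSpace 𝕜 E]
    (η : Cardinal.{u}) (K : ℝ) (X : Set E) : Prop :=
  Cardinal.mk ↥X = η ∧ (∃ M : ℝ, ∀ x ∈ X, ‖x‖ ≤ M) ∧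
    ∀ (p : ℕ) (z : Fin p → 𝕜) (x : Fin p → E), Function.Injective x →
      (∀ n, x n ∈ X) → ∑ n, ‖z n‖ ≤ K * ‖∑ n, z n • x n‖

variable (A : Type u) [NonUnitalNormedRing A] [NormedSpace 𝕜 A]
  [IsScalarTower 𝕜 A A] [SMulCommClass 𝕜 A A]

/-- The right action of `A` on `A*`:  `(fφ)(ψ) = f(φψ)`. -/
def lAct (f : A →L[𝕜] 𝕜) (φ : A) : A →L[𝕜] 𝕜 :=
  f.comp (ContinuousLinearMap.mul 𝕜 A φ)

/-- A functional `f ∈ A*` is weakly almost periodic when its left orbit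
`{fφ : ‖φ‖ ≤ 1}` is relatively compact in the weak topology `σ(A*, A**)`. -/
def IsWAP (f : A →L[𝕜] 𝕜) : Prop :=
  IsCompact (closure ((toWeakSpace 𝕜 (A →L[𝕜] 𝕜)) ''
    {g | ∃ φ : A, ‖φ‖ ≤ 1 ∧ g = lAct 𝕜 A f φ}))

/-- `W(A)`: the closed linear subspace of `A*` spanned by the weakly almost periodic
functionals. -/
def WAP : Submodule 𝕜 (A →L[𝕜] 𝕜) :=
  (Submodule.span 𝕜 {f | IsWAP 𝕜 A f}).topologicalClosure

instance WAP_isClosed : IsClosed ((WAP 𝕜 A : Submodule 𝕜 (A →L[𝕜] 𝕜)) : Set (A →L[𝕜] 𝕜)) :=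
  Submodule.isClosed_topologicalClosure _

/-- A Banach algebra is extremely non-Arens regular when `A*/W(A)` contains a closed
subspace which has `A*` as a quotient (i.e. admits a bounded linear surjection onto `A*`). -/
def ExtremelyNonArensRegular : Prop :=
  ∃ S : Submodule 𝕜 ((A →L[𝕜] 𝕜) ⧸ WAP 𝕜 A),
    IsClosed (S : Set ((A →L[𝕜] 𝕜) ⧸ WAP 𝕜 A)) ∧
    ∃ T : ↥S →L[𝕜] (A →L[𝕜] 𝕜), Function.Surjective T

end Paper

namespace Paper

open Cardinal in
/-- A family of sets indexed by `J`, each of cardinality at least `#J`, has an injective choice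
function. -/
theorem exists_injective_choice {J P : Type u} (S : J → Set P) (hS : ∀ j, #J ≤ #(S j)) :
    ∃ g : J → P, Function.Injective g ∧ ∀ j, g j ∈ S j := by
  obtain ⟨_, _, hord⟩ := exists_ord_eq_type_lt J
  have hex : ∀ (j : J) (f : ∀ k, k < j → P), ∃ p ∈ S j, ∀ k hk, f k hk ≠ p := by
    intro j f
    by_contra! h
    have hsub : S j ⊆ Set.range fun k : Set.Iio j => f k.1 k.2 := by
      intro p hp
      obtain ⟨k, hk, h⟩ := h p hp
      exact ⟨⟨k, hk⟩, h⟩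
    exact ((hS j).trans ((mk_le_mk_of_subset hsub).trans mk_range_le)).not_gt (mk_Iio_lt j hord)
  choose F hFS hF using hex
  let g : J → P := wellFounded_lt.fix F
  have hg : ∀ j, g j = F j fun k _ => g k := wellFounded_lt.fix_eq F
  have hne : ∀ j k, k < j → g k ≠ g j := by
    intro j k hk h
    rw [hg j] at h
    exact hF j (fun k _ => g k) k hk h
  refine ⟨g, fun j k h => ?_, fun j => hg j ▸ hFS _ _⟩
  rcases lt_trichotomy j k with hjk | hjk | hjk
  · exact absurd h (hne _ _ hjk)
  · exact hjk
  · exact absurd h.symm (hne _ _ hjk)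

open Cardinal in
/-- A directed set of infinite true cardinality `#ι` can be coloured by `ι` so that every colour
class is cofinal. -/
theorem exists_frequently_coloring {P ι : Type u} [Preorder P] [Nonempty P]
    [IsDirected P (· ≤ ·)] (hι : ℵ₀ ≤ #ι) (htr : trueCard P = #ι) :
    ∃ col : P → ι, ∀ i, ∃ᶠ p in atTop, col p = i := by
  obtain ⟨ξ₀, hξ₀⟩ : ∃ ξ : P, #{α : P // ξ < α} = #ι :=
    htr ▸ ciInf_mem fun ξ : P => #{α : P // ξ < α}
  have htr_le : ∀ ξ : P, #ι ≤ #{α : P // ξ < α} := fun ξ => by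
    rw [← htr]
    exact ciInf_le' _ ξ
  have hlt : ∀ ξ : P, ∃ α, ξ < α := fun ξ => by
    have : #{α : P // ξ < α} ≠ 0 := (aleph0_pos.trans_le (hι.trans (htr_le ξ))).ne'
    obtain ⟨α⟩ := mk_ne_zero_iff.1 this
    exact ⟨α.1, α.2⟩
  have hJ : #({α : P // ξ₀ < α} × ι) = #ι := by
    rw [mk_prod, lift_id, lift_id, hξ₀, mul_eq_self hι]
  obtain ⟨g, hg, hgS⟩ := exists_injective_choice
    (fun j : {α : P // ξ₀ < α} × ι => {p | j.1.1 < p}) fun j => hJ.trans_le (htr_le j.1.1)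
  have : Nonempty ι := mk_ne_zero_iff.1 (aleph0_pos.trans_le hι).ne'
  have : Nonempty {α : P // ξ₀ < α} := let ⟨α, hα⟩ := hlt ξ₀; ⟨⟨α, hα⟩⟩
  refine ⟨fun p => (Function.invFun g p).2, fun i => frequently_atTop.2 fun ξ => ?_⟩
  obtain ⟨q, hξq, hξ₀q⟩ := exists_ge_ge ξ ξ₀
  obtain ⟨p, hqp⟩ := hlt q
  have hpg : p < g (⟨p, hξ₀q.trans_lt hqp⟩, i) :=
    hgS (⟨p, hξ₀q.trans_lt hqp⟩, i)
  refine ⟨g (⟨p, hξ₀q.trans_lt hqp⟩, i), (hξq.trans_lt (hqp.trans hpg)).le, ?_⟩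
  simp only [Function.leftInverse_invFun hg _]

theorem Cofinal.isDirected {Λ : Type*} [Preorder Λ] [IsDirected Λ (· ≤ ·)] {S : Set Λ}
    (hS : Cofinal S) : IsDirected S (· ≤ ·) where
  directed x y := by
    obtain ⟨z, hxz, hyz⟩ := exists_ge_ge (x : Λ) y
    obtain ⟨w, hw, hzw⟩ := hS z
    exact ⟨⟨w, hw⟩, hxz.trans hzw, hyz.trans hzw⟩

theorem Cofinal.nonempty {Λ : Type*} [Preorder Λ] [Nonempty Λ] {S : Set Λ}
    (hS : Cofinal S) : Nonempty S :=
  let ⟨α, hα, _⟩ := hS (Classical.arbitrary Λ)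
  ⟨⟨α, hα⟩⟩

/-- A bounded family of functionals converges pointwise along every ultrafilter. -/
theorem exists_tendsto_ultrafilter {𝕜 E P : Type*} [RCLike 𝕜] [NormedAddCommGroup E]
    [NormedSpace 𝕜 E] (V : Ultrafilter P) (F : P → E →L[𝕜] 𝕜) {C : ℝ} (hF : ∀ p, ‖F p‖ ≤ C) :
    ∃ L : E →L[𝕜] 𝕜, ‖L‖ ≤ C ∧ ∀ x, Tendsto (fun p => F p x) V (𝓝 (L x)) := by
  obtain ⟨L, hL, hVL⟩ := (WeakDual.isCompact_closedBall (𝕜 := 𝕜) (E := E) 0 C).ultrafilter_le_nhds'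
    (V.map fun p => StrongDual.toWeakDual (F p)) <| by
      refine Ultrafilter.mem_map.2 (univ_mem' fun p => ?_)
      simpa using hF p
  refine ⟨WeakDual.toStrongDual L, by simpa using hL, fun x => ?_⟩
  exact ((WeakDual.eval_continuous x).tendsto L).comp hVL

/-- A bounded function on an `ℓ¹`-base extends to a bounded functional. -/
theorem IsL1Base.exists_functional {𝕜 E : Type u} [RCLike 𝕜] [NormedAddCommGroup E]
    [NormedSpace 𝕜 E] {η : Cardinal.{u}} {K : ℝ} {X : Set E} (hX : IsL1Base 𝕜 η K X)
    (h : E → 𝕜) {C : ℝ} (hC : ∀ x, ‖h x‖ ≤ C) :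
    ∃ f : E →L[𝕜] 𝕜, ∀ x ∈ X, f x = h x := by
  have hC0 : 0 ≤ C := (norm_nonneg _).trans (hC 0)
  have hbound : ∀ l : X →₀ 𝕜,
      l.sum (fun _ z => ‖z‖) ≤ K * ‖Finsupp.linearCombination 𝕜 (Subtype.val : X → E) l‖ := by
    intro l
    let e := l.support.equivFin.symm
    have := hX.2.2 _ (fun n => l (e n)) (fun n => ((e n : X) : E))
      (Subtype.val_injective.comp (Subtype.val_injective.comp e.injective)) fun n => (e n : X).2
    rw [Equiv.sum_comp e fun x => ‖l x‖, Equiv.sum_comp e fun x => l x • ((x : X) : E),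
      Finset.sum_coe_sort l.support fun x => ‖l x‖,
      Finset.sum_coe_sort l.support fun x => l x • (x : E)] at this
    simpa [Finsupp.sum, Finsupp.linearCombination_apply] using this
  have hli : LinearIndependent 𝕜 (Subtype.val : X → E) := by
    refine linearIndependent_iff.2 fun l hl => ?_
    have hs := hbound l
    rw [hl, norm_zero, mul_zero] at hs
    have hs0 := (Finset.sum_eq_zero_iff_of_nonneg fun x _ => norm_nonneg (l x)).1
      (le_antisymm hs (Finset.sum_nonneg fun x _ => norm_nonneg (l x)))
    ext x
    by_cases hx : x ∈ l.support
    · simpa using hs0 x hx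
    · simpa using hx
  let f₀ := (Finsupp.linearCombination 𝕜 fun x : X => h x).comp hli.repr
  have hf₀ : ∀ v, ‖f₀ v‖ ≤ C * K * ‖v‖ := by
    intro v
    calc ‖f₀ v‖ = ‖(hli.repr v).sum fun x z => z • h x‖ := by
          simp [f₀, Finsupp.linearCombination_apply]
      _ ≤ (hli.repr v).sum fun _ z => C * ‖z‖ := by
          refine (norm_sum_le _ _).trans (Finset.sum_le_sum fun x _ => ?_)
          rw [norm_smul, mul_comm]
          exact mul_le_mul_of_nonneg_right (hC _) (norm_nonneg _)
      _ = C * (hli.repr v).sum fun _ z => ‖z‖ := by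
          rw [Finsupp.mul_sum]
      _ ≤ C * (K * ‖v‖) := by
          have := hbound (hli.repr v)
          rw [hli.linearCombination_repr] at this
          exact mul_le_mul_of_nonneg_left this hC0
      _ = C * K * ‖v‖ := by ring
  obtain ⟨f, hf, -⟩ := exists_extension_norm_eq _ (f₀.mkContinuous _ hf₀)
  refine ⟨f, fun x hx => ?_⟩
  have hxs : x ∈ Submodule.span 𝕜 (Set.range (Subtype.val : X → E)) :=
    Submodule.subset_span ⟨⟨x, hx⟩, rfl⟩
  have := hf ⟨x, hxs⟩
  rw [LinearMap.mkContinuous_apply] at this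
  refine this.trans ?_
  simp [f₀, hli.repr_eq_single ⟨x, hx⟩ ⟨x, hxs⟩ rfl]

section

variable {𝕜 A : Type u} [RCLike 𝕜] [NonUnitalNormedRing A] [NormedSpace 𝕜 A]
  [IsScalarTower 𝕜 A A] [SMulCommClass 𝕜 A A]

/-- The orbit of a weakly almost periodic functional along a bounded family converges weakly
along every ultrafilter. -/
theorem IsWAP.exists_tendsto {f : A →L[𝕜] 𝕜} (hf : IsWAP 𝕜 A f) {P : Type*} (V : Ultrafilter P)
    {a : P → A} {C : ℝ} (ha : ∀ p, ‖a p‖ ≤ C) :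
    ∃ g : A →L[𝕜] 𝕜, ∀ B : (A →L[𝕜] 𝕜) →L[𝕜] 𝕜,
      Tendsto (fun p => B (lAct 𝕜 A f (a p))) V (𝓝 (B g)) := by
  set D : ℝ := max C 1
  have hD : 0 < D := lt_max_of_lt_right one_pos
  obtain ⟨g, -, hVg⟩ := hf.ultrafilter_le_nhds'
    (V.map fun p => toWeakSpace 𝕜 (A →L[𝕜] 𝕜) (lAct 𝕜 A f ((D⁻¹ : 𝕜) • a p))) <| by
      refine Ultrafilter.mem_map.2 (univ_mem' fun p => ?_)
      refine subset_closure ⟨_, ⟨_, ?_, rfl⟩, rfl⟩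
      rw [norm_smul, norm_inv, RCLike.norm_ofReal, abs_of_pos hD, inv_mul_le_one₀ hD]
      exact (ha p).trans (le_max_left _ _)
  refine ⟨(D : 𝕜) • (toWeakSpace 𝕜 (A →L[𝕜] 𝕜)).symm g, fun B => ?_⟩
  have hB : Tendsto (fun p => B (lAct 𝕜 A f ((D⁻¹ : 𝕜) • a p))) V
      (𝓝 (B ((toWeakSpace 𝕜 (A →L[𝕜] 𝕜)).symm g))) :=
    ((WeakBilin.eval_continuous _ B).tendsto g).comp hVg
  have hD' : (D : 𝕜) ≠ 0 := by exact_mod_cast hD.ne'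
  rw [map_smul]
  refine (hB.const_smul (D : 𝕜)).congr fun p => ?_
  rw [← map_smul]
  congr 1
  ext ψ
  simp [lAct, hD']

/-- The difference of the two iterated limits of `f (a α * b β)` along ultrafilters is a bounded
functional of `f` which vanishes on the weakly almost periodic functionals. -/
theorem exists_iterated_limit_difference {P Q : Type*} (V : Ultrafilter P) (U : Ultrafilter Q)
    {a : P → A} {b : Q → A} {C : ℝ} (ha : ∀ p, ‖a p‖ ≤ C) (hb : ∀ q, ‖b q‖ ≤ C) :
    ∃ τ : (A →L[𝕜] 𝕜) →L[𝕜] 𝕜, ‖τ‖ ≤ 2 * C ^ 2 ∧ (∀ f, IsWAP 𝕜 A f → τ f = 0) ∧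
      ∀ f s t, (∀ p, Tendsto (fun q => f (a p * b q)) U (𝓝 s)) →
        (∀ᶠ q in U, Tendsto (fun p => f (a p * b q)) V (𝓝 t)) → τ f = s - t := by
  obtain ⟨p₀⟩ : Nonempty P := V.nonempty_of_neBot
  have hC : 0 ≤ C := (norm_nonneg _).trans (ha p₀)
  let ev := NormedSpace.inclusionInDoubleDual 𝕜 A
  have hev : ∀ x f, ev x f = f x := fun x f => NormedSpace.dual_def 𝕜 A x f
  have hev_le : ∀ x, ‖ev x‖ ≤ ‖x‖ := NormedSpace.double_dual_bound 𝕜 A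
  have hmul : ∀ p q, ‖ev (a p * b q)‖ ≤ C ^ 2 := fun p q =>
    (hev_le _).trans ((norm_mul_le _ _).trans (by
      rw [sq]; exact mul_le_mul (ha p) (hb q) (norm_nonneg _) hC))
  choose R hR_le hR using fun p => exists_tendsto_ultrafilter U (fun q => ev (a p * b q)) (hmul p)
  choose S hS_le hS using fun q =>
    exists_tendsto_ultrafilter V (fun p => ev (a p * b q)) fun p => hmul p q
  obtain ⟨R', hR'_le, hR'⟩ := exists_tendsto_ultrafilter V R hR_le
  obtain ⟨S', hS'_le, hS'⟩ := exists_tendsto_ultrafilter U S hS_le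
  obtain ⟨B, -, hB⟩ := exists_tendsto_ultrafilter U (fun q => ev (b q)) fun q =>
    (hev_le _).trans (hb q)
  refine ⟨R' - S', (norm_sub_le R' S').trans (by linarith), fun f hf => ?_, fun f s t hs ht => ?_⟩
  · obtain ⟨g, hg⟩ := hf.exists_tendsto V ha
    have hact : ∀ p q, ev (b q) (lAct 𝕜 A f (a p)) = ev (a p * b q) f := fun p q => by
      simp [hev, lAct]
    have hRB : ∀ p, R p f = B (lAct 𝕜 A f (a p)) := fun p =>
      tendsto_nhds_unique (hR p f) ((hB (lAct 𝕜 A f (a p))).congr (hact p))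
    have hSg : ∀ q, S q f = ev (b q) g := fun q =>
      tendsto_nhds_unique (hS q f) ((hg (ev (b q))).congr fun p => hact p q)
    have hR'g : R' f = B g := tendsto_nhds_unique (hR' f) ((hg B).congr fun p => (hRB p).symm)
    have hS'g : S' f = B g := tendsto_nhds_unique (hS' f) ((hB g).congr fun q => (hSg q).symm)
    rw [sub_apply, hR'g, hS'g, sub_self]
  · have hRs : ∀ p, R p f = s := fun p => tendsto_nhds_unique (hR p f) (by simpa [hev] using hs p)
    have hSt : ∀ᶠ q in U, S q f = t := ht.mono fun q hq =>
      tendsto_nhds_unique (hS q f) (by simpa [hev] using hq)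
    have hR's : R' f = s := tendsto_nhds_unique (hR' f) (by simp [hRs])
    have hS't : S' f = t := tendsto_nhds_unique (hS' f)
      (tendsto_const_nhds.congr' (hSt.mono fun _ h => h.symm))
    rw [sub_apply, hR's, hS't]

/-- If bounded functionals on `A*` of uniformly bounded norm vanish on the weakly almost periodic
functionals and interpolate every element of `ℓ∞`, then `ℓ∞` is a quotient of `A*/W(A)`. -/
theorem exists_surjection_of_interpolating {ι : Type u} (τ : ι → (A →L[𝕜] 𝕜) →L[𝕜] 𝕜) {C : ℝ}
    (hC : 0 ≤ C) (hτ : ∀ i, ‖τ i‖ ≤ C) (hW : ∀ i f, IsWAP 𝕜 A f → τ i f = 0)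
    (hsurj : ∀ c : lp (fun _ : ι => 𝕜) ∞, ∃ f, ∀ i, τ i f = c i) :
    ∃ T : ((A →L[𝕜] 𝕜) ⧸ WAP 𝕜 A) →L[𝕜] lp (fun _ : ι => 𝕜) ∞, Function.Surjective T := by
  have hle : ∀ f i, ‖τ i f‖ ≤ C * ‖f‖ := fun f i => (τ i).le_of_opNorm_le (hτ i) f
  let T₀ : (A →L[𝕜] 𝕜) →L[𝕜] lp (fun _ : ι => 𝕜) ∞ :=
    LinearMap.mkContinuous
      { toFun := fun f => ⟨fun i => τ i f, memℓp_infty ⟨C * ‖f‖, by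
          rintro _ ⟨i, rfl⟩
          exact hle f i⟩⟩
        map_add' := fun f g => by ext i; simp; rfl
        map_smul' := fun z f => by ext i; simp } C fun f =>
      lp.norm_le_of_forall_le (by positivity) (hle f)
  have hker : WAP 𝕜 A ≤ T₀.ker := by
    refine Submodule.topologicalClosure_minimal _ (Submodule.span_le.2 fun f hf => ?_)
      T₀.isClosed_ker
    change T₀ f = 0
    ext i
    exact hW i f hf
  refine ⟨(WAP 𝕜 A).liftQL T₀ hker, fun c => ?_⟩
  obtain ⟨f, hf⟩ := hsurj c
  refine ⟨(WAP 𝕜 A).mkQ f, ?_⟩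
  ext i
  exact hf i

end

/-- The dual of a normed space of density character at most `#ι` embeds isometrically
into `ℓ∞(ι)`. -/
theorem exists_dual_linearIsometry {𝕜 E ι : Type u} [RCLike 𝕜] [NormedAddCommGroup E]
    [NormedSpace 𝕜 E] (hd : densityChar E ≤ Cardinal.mk ι) :
    Nonempty ((E →L[𝕜] 𝕜) →ₗᵢ[𝕜] lp (fun _ : ι => 𝕜) ∞) := by
  have : Nonempty {s : Set E // Dense s} := ⟨⟨Set.univ, dense_univ⟩⟩
  obtain ⟨⟨D, hD⟩, hDcard⟩ : ∃ s : {s : Set E // Dense s}, Cardinal.mk ↥(s.1) = densityChar E :=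
    ciInf_mem fun s : {s : Set E // Dense s} => Cardinal.mk ↥(s.1)
  obtain ⟨e⟩ : Nonempty (D ↪ ι) := hDcard.trans_le hd
  have : Nonempty D := hD.nonempty.to_subtype
  let v : ι → D := Function.invFun e
  let u : ι → E := fun i => ((‖(v i : E)‖⁻¹ : ℝ) : 𝕜) • (v i : E)
  have hu : ∀ i, ‖u i‖ ≤ 1 := fun i => by
    simp only [u, norm_smul, RCLike.norm_ofReal, abs_inv, abs_norm]
    exact inv_mul_le_one
  have hle : ∀ (f : E →L[𝕜] 𝕜) i, ‖f (u i)‖ ≤ ‖f‖ := fun f i => f.unit_le_opNorm _ (hu i)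
  refine ⟨⟨⟨⟨fun f => ⟨fun i => f (u i), memℓp_infty ⟨‖f‖, ?_⟩⟩, fun f g => ?_⟩, fun z f => ?_⟩,
    fun f => ?_⟩⟩
  · rintro _ ⟨i, rfl⟩
    exact hle f i
  · ext i; simp; rfl
  · ext i; simp
  · refine le_antisymm (lp.norm_le_of_forall_le (norm_nonneg _) (hle f)) ?_
    refine f.opNorm_le_bound (norm_nonneg _) fun x => ?_
    refine hD.induction (P := fun x => ‖f x‖ ≤ _ * ‖x‖) (fun d hd => ?_)
      (isClosed_le (by fun_prop) (by fun_prop)) x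
    rcases eq_or_ne d 0 with rfl | hd0
    · simp
    have hud : u (e ⟨d, hd⟩) = ((‖d‖⁻¹ : ℝ) : 𝕜) • d := by
      simp only [u, v, Function.leftInverse_invFun e.injective _]
    rw [← div_le_iff₀ (norm_pos_iff.2 hd0)]
    refine le_trans (le_of_eq ?_) (lp.norm_apply_le_norm ENNReal.top_ne_zero _ (e ⟨d, hd⟩))
    change _ = ‖f (u (e ⟨d, hd⟩))‖
    rw [hud, map_smul, norm_smul, RCLike.norm_ofReal, abs_inv, abs_norm, div_eq_inv_mul]

theorem exists_closed_subspace_surjection {𝕜 E F G : Type*} [RCLike 𝕜] [NormedAddCommGroup E]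
    [NormedSpace 𝕜 E] [CompleteSpace E] [NormedAddCommGroup F] [NormedSpace 𝕜 F]
    [AddCommGroup G] [Module 𝕜 G] [TopologicalSpace G]
    (J : E →ₗᵢ[𝕜] F) (T : G →L[𝕜] F) (hT : Function.Surjective T) :
    ∃ S : Submodule 𝕜 G, IsClosed (S : Set G) ∧ ∃ R : S →L[𝕜] E, Function.Surjective R := by
  let S : Submodule 𝕜 G := (J.toLinearMap.range).comap T.toLinearMap
  have hrange : IsClosed (Set.range J) := J.isometry.isClosedEmbedding.isClosed_range
  have hS : ∀ x : S, T x ∈ J.toLinearMap.range := fun x => x.2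
  refine ⟨S, hrange.preimage T.continuous,
    (J.equivRange.symm : _ →L[𝕜] E).comp ((T.comp S.subtypeL).codRestrict _ hS), fun x => ?_⟩
  obtain ⟨y, hy⟩ := hT (J x)
  refine ⟨⟨y, x, hy.symm⟩, J.equivRange.injective ?_⟩
  ext
  exact (congrArg Subtype.val (J.equivRange.apply_symm_apply _)).trans hy

theorem tendsto_of_eventually_eq_approx {𝕜 E P : Type*} [RCLike 𝕜] [NormedAddCommGroup E]
    [NormedSpace 𝕜 E] {l : Filter P} (f : E →L[𝕜] 𝕜) {x y : P → E} {s : 𝕜}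
    (hs : ∀ᶠ p in l, f (x p) = s) (hxy : ∀ ε > 0, ∀ᶠ p in l, ‖x p - y p‖ < ε) :
    Tendsto (fun p => f (y p)) l (𝓝 s) := by
  have h0 : Tendsto (fun p => x p - y p) l (𝓝 0) := by
    rw [Metric.tendsto_nhds]
    simpa using hxy
  have h1 : Tendsto (fun p => s - f (x p - y p)) l (𝓝 (s - f 0)) :=
    tendsto_const_nhds.sub ((f.continuous.tendsto 0).comp h0)
  rw [map_zero, sub_zero] at h1
  refine h1.congr' ?_
  filter_upwards [hs] with p hp
  rw [map_sub, hp, sub_sub_cancel]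

/-- An indexed family in which equal values have equal second index factors, through its values,
any function of the second index. -/
theorem exists_factor_snd {P Q E κ : Type*} {U : Set (P × Q)} {x : P → Q → E}
    (hinj : ∀ p ∈ U, ∀ q ∈ U, x p.1 p.2 = x q.1 q.2 → p.2 = q.2) [Nonempty Q] (c : Q → κ) :
    ∃ h : E → κ, (∀ p ∈ U, h (x p.1 p.2) = c p.2) ∧ ∀ y, ∃ q, h y = c q := by
  classical
  obtain ⟨q₀⟩ := ‹Nonempty Q›
  refine ⟨fun y => if hy : ∃ p ∈ U, x p.1 p.2 = y then c hy.choose.2 else c q₀, fun p hp => ?_,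
    fun y => ?_⟩
  · have hy : ∃ q ∈ U, x q.1 q.2 = x p.1 p.2 := ⟨p, hp, rfl⟩
    simp only [dif_pos hy]
    rw [hinj _ hy.choose_spec.1 p hp hy.choose_spec.2]
  · dsimp only
    split_ifs with hy
    exacts [⟨_, rfl⟩, ⟨_, rfl⟩]

/-- A bounded function of the second index of a vertically injective part `Y` of an `ℓ¹`-base
extends to a functional vanishing on a disjoint part `Z`. -/
theorem IsL1Base.exists_functional_snd {𝕜 E : Type u} [RCLike 𝕜] [NormedAddCommGroup E]
    [NormedSpace 𝕜 E] {η : Cardinal.{u}} {K : ℝ} {X Y Z : Set E} (hX : IsL1Base 𝕜 η K X)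
    (hY : Y ⊆ X) (hZ : Z ⊆ X) (hYZ : Disjoint Y Z) {P Q : Type*} [Nonempty Q]
    {U : Set (P × Q)} {x : P → Q → E} (hx : ∀ p ∈ U, x p.1 p.2 ∈ Y)
    (hinj : ∀ p ∈ U, ∀ q ∈ U, x p.1 p.2 = x q.1 q.2 → p.2 = q.2) {c : Q → 𝕜} {C : ℝ}
    (hc : ∀ q, ‖c q‖ ≤ C) :
    ∃ f : E →L[𝕜] 𝕜, (∀ p ∈ U, f (x p.1 p.2) = c p.2) ∧ ∀ z ∈ Z, f z = 0 := by
  classical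
  obtain ⟨h, hU, hrange⟩ := exists_factor_snd hinj c
  have hbd : ∀ y, ‖h y‖ ≤ C := fun y => by
    obtain ⟨q, hq⟩ := hrange y
    exact hq ▸ hc q
  obtain ⟨f, hf⟩ := hX.exists_functional (Y.indicator h)
    fun y => (norm_indicator_le_norm_self h y).trans (hbd y)
  refine ⟨f, fun p hp => ?_, fun z hz => ?_⟩
  · rw [hf _ (hY (hx p hp)), Set.indicator_of_mem (hx p hp), hU p hp]
  · rw [hf z (hZ hz), Set.indicator_of_notMem (hYZ.notMem_of_mem_right hz)]

/-- under the triangle criterion hypotheses there is a bounded linear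
surjection from `A*/W(A)` onto `ℓ∞(η)`; if moreover the density character of `A` is at
most `η`, then `A` is extremely non-Arens regular. -/
theorem statement5
    (𝕜 A : Type u) [RCLike 𝕜] [NonUnitalNormedRing A] [NormedSpace 𝕜 A]
    [IsScalarTower 𝕜 A A] [SMulCommClass 𝕜 A A] [CompleteSpace A]
    (η : Cardinal.{u}) (hη : Cardinal.aleph0 ≤ η)
    (ι : Type u) (hι : Cardinal.mk ι = η)
    (Λ : Type u) [Preorder Λ] [Nonempty Λ] [IsDirected Λ (· ≤ ·)]
    (Λ₁ Λ₂ : Set Λ) (hcof₁ : Cofinal Λ₁) (hcof₂ : Cofinal Λ₂)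
    (htr₁ : trueCard ↥Λ₁ = η) (htr₂ : trueCard ↥Λ₂ = η)
    (a : ↥Λ₁ → A) (b : ↥Λ₂ → A)
    (Cab : ℝ) (ha : ∀ α, ‖a α‖ ≤ Cab) (hb : ∀ β, ‖b β‖ ≤ Cab)
    (X₁ X₂ : Set A) (hdisj : Disjoint X₁ X₂)
    (K M : ℝ) (hK : 0 < K) (hM : 0 < M)
    -- (i) `X = X₁ ∪ X₂` is an `ℓ¹(η)`-base with constant `K` inside the ball of radius `M`
    (hbase : IsL1Base 𝕜 η K (X₁ ∪ X₂))
    (hball : X₁ ∪ X₂ ⊆ Metric.closedBall (0 : A) M)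
    -- (ii) `X₁` approximates segments in the upper triangle `T^u_{AB}` …
    (U₁ : Set (↥Λ₁ × ↥Λ₂)) (x₁ : ↥Λ₁ → ↥Λ₂ → A)
    (hU₁lt : ∀ p ∈ U₁, (p.1 : Λ) < (p.2 : Λ))
    (hU₁cof : ∀ α : ↥Λ₁, ∃ β₀ : ↥Λ₂, ∀ β : ↥Λ₂, β₀ ≤ β → (α, β) ∈ U₁)
    (hX₁ : X₁ = {y : A | ∃ p ∈ U₁, y = x₁ p.1 p.2})
    (hlim₁ : ∀ (α : ↥Λ₁) (ε : ℝ), 0 < ε → ∃ β₀ : ↥Λ₂, ∀ β : ↥Λ₂, β₀ ≤ β →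
      (α, β) ∈ U₁ → ‖x₁ α β - a α * b β‖ < ε)
    -- … and `X₂` approximates segments in the lower triangle `T^l_{AB}`
    (U₂ : Set (↥Λ₁ × ↥Λ₂)) (x₂ : ↥Λ₁ → ↥Λ₂ → A)
    (hU₂lt : ∀ p ∈ U₂, (p.2 : Λ) < (p.1 : Λ))
    (hU₂cof : ∀ β : ↥Λ₂, ∃ α₀ : ↥Λ₁, ∀ α : ↥Λ₁, α₀ ≤ α → (α, β) ∈ U₂)
    (hX₂ : X₂ = {y : A | ∃ p ∈ U₂, y = x₂ p.1 p.2})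
    (hlim₂ : ∀ (β : ↥Λ₂) (ε : ℝ), 0 < ε → ∃ α₀ : ↥Λ₁, ∀ α : ↥Λ₁, α₀ ≤ α →
      (α, β) ∈ U₂ → ‖x₂ α β - a α * b β‖ < ε)
    -- (iii) either `X₁` is vertically injective and `X₂` horizontally injective, or vice versa
    (hinj :
      ((∀ p ∈ U₁, ∀ q ∈ U₁, x₁ p.1 p.2 = x₁ q.1 q.2 → p.2 = q.2) ∧
        (∀ p ∈ U₂, ∀ q ∈ U₂, x₂ p.1 p.2 = x₂ q.1 q.2 → p.1 = q.1)) ∨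
      ((∀ p ∈ U₁, ∀ q ∈ U₁, x₁ p.1 p.2 = x₁ q.1 q.2 → p.1 = q.1) ∧
        (∀ p ∈ U₂, ∀ q ∈ U₂, x₂ p.1 p.2 = x₂ q.1 q.2 → p.2 = q.2)))
    :
    (∃ T : ((A →L[𝕜] 𝕜) ⧸ WAP 𝕜 A) →L[𝕜] lp (fun _ : ι => 𝕜) ∞, Function.Surjective T) ∧
    (densityChar A ≤ η → ExtremelyNonArensRegular 𝕜 A) := by
  subst hι
  have := hcof₁.isDirected
  have := hcof₂.isDirected
  have := hcof₁.nonempty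
  have := hcof₂.nonempty
  have key : ∃ T : ((A →L[𝕜] 𝕜) ⧸ WAP 𝕜 A) →L[𝕜] lp (fun _ : ι => 𝕜) ∞,
      Function.Surjective T := by
    obtain ⟨col, hcol⟩ := exists_frequently_coloring hη htr₂
    have hne : ∀ i, NeBot (atTop ⊓ 𝓟 {β | col β = i}) := fun i =>
      frequently_mem_iff_neBot.1 (hcol i)
    let V : Ultrafilter Λ₁ := Ultrafilter.of atTop
    let U : ι → Ultrafilter Λ₂ := fun i => Ultrafilter.of (atTop ⊓ 𝓟 {β | col β = i})
    have hV : (V : Filter Λ₁) ≤ atTop := Ultrafilter.of_le _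
    have hU : ∀ i, (U i : Filter Λ₂) ≤ atTop := fun i => (Ultrafilter.of_le _).trans inf_le_left
    have hUcol : ∀ i, ∀ᶠ β in U i, col β = i := fun i =>
      le_principal_iff.1 ((Ultrafilter.of_le _).trans inf_le_right)
    choose τ hτ_le hτW hτ using fun i =>
      exists_iterated_limit_difference (𝕜 := 𝕜) V (U i) ha hb
    refine exists_surjection_of_interpolating τ (by positivity) hτ_le hτW fun c => ?_
    have hc : ∀ β, ‖c (col β)‖ ≤ ‖c‖ := fun β => lp.norm_apply_le_norm ENNReal.top_ne_zero c _
    have hmem₁ : ∀ p ∈ U₁, x₁ p.1 p.2 ∈ X₁ := fun p hp => hX₁ ▸ ⟨p, hp, rfl⟩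
    have hmem₂ : ∀ p ∈ U₂, x₂ p.1 p.2 ∈ X₂ := fun p hp => hX₂ ▸ ⟨p, hp, rfl⟩
    have hU₁ : ∀ α, ∀ᶠ β in atTop, (α, β) ∈ U₁ := fun α => eventually_atTop.2 (hU₁cof α)
    have hU₂ : ∀ β, ∀ᶠ α in atTop, (α, β) ∈ U₂ := fun β => eventually_atTop.2 (hU₂cof β)
    have hl₁ : ∀ α, ∀ ε > 0, ∀ᶠ β in atTop, ‖x₁ α β - a α * b β‖ < ε := fun α ε hε => by
      filter_upwards [hU₁ α, eventually_atTop.2 (hlim₁ α ε hε)] with β h h' using h' h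
    have hl₂ : ∀ β, ∀ ε > 0, ∀ᶠ α in atTop, ‖x₂ α β - a α * b β‖ < ε := fun β ε hε => by
      filter_upwards [hU₂ β, eventually_atTop.2 (hlim₂ β ε hε)] with α h h' using h' h
    rcases hinj with ⟨hinj, -⟩ | ⟨-, hinj⟩
    · obtain ⟨f, hfY, hfZ⟩ := hbase.exists_functional_snd Set.subset_union_left
        Set.subset_union_right hdisj hmem₁ hinj hc
      refine ⟨f, fun i => (hτ i f (c i) 0 (fun α => ?_)
        (Eventually.of_forall fun β => ?_)).trans (sub_zero _)⟩
      · refine tendsto_of_eventually_eq_approx f (x := x₁ α) ?_ fun ε hε => hU i (hl₁ α ε hε)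
        filter_upwards [hU i (hU₁ α), hUcol i] with β hβ hcolβ
        rw [hfY _ hβ, hcolβ]
      · refine tendsto_of_eventually_eq_approx f (x := fun α => x₂ α β) ?_
          fun ε hε => hV (hl₂ β ε hε)
        filter_upwards [hV (hU₂ β)] with α hα using hfZ _ (hmem₂ _ hα)
    · obtain ⟨f, hfY, hfZ⟩ := hbase.exists_functional_snd (c := fun β => -c (col β))
        Set.subset_union_right Set.subset_union_left hdisj.symm hmem₂ hinj
        fun β => (norm_neg _).trans_le (hc β)
      refine ⟨f, fun i => (hτ i f 0 (-c i) (fun α => ?_)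
        ((hUcol i).mono fun β hcolβ => ?_)).trans (by simp)⟩
      · refine tendsto_of_eventually_eq_approx f (x := x₁ α) ?_ fun ε hε => hU i (hl₁ α ε hε)
        filter_upwards [hU i (hU₁ α)] with β hβ using hfZ _ (hmem₁ _ hβ)
      · refine tendsto_of_eventually_eq_approx f (x := fun α => x₂ α β) ?_
          fun ε hε => hV (hl₂ β ε hε)
        filter_upwards [hV (hU₂ β)] with α hα
        rw [hfY _ hα, hcolβ]
  refine ⟨key, fun hd => ?_⟩
  obtain ⟨T, hT⟩ := key
  obtain ⟨J⟩ := exists_dual_linearIsometry (𝕜 := 𝕜) hd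
  exact exists_closed_subspace_surjection J T hT

end Paper
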